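/- arXiv:2306.13635 — 2 statements merged into one kernel-verified Lean document; each statement's English description precedes it below -/
import Mathlib

section
/- Let m ≥ 1 and let c : ℤ → ℂ be an even sequence, i.e. c(−n) = c(n) for all n ∈ ℤ. Then the 2m×2m Toeplitz determinant factors as det[(c(j−k))_{0≤j,k≤2m−1}] = det[(c(j−k) + c(j+k+1))_{0≤j,k≤m−1}] · det[(c(j−k) − c(j+k+1))_{0≤j,k≤m−1}]. -/
/-- A block matrix with equal diagonal blocks and equal off-diagonal blocks has determinant
`det (A + B) * det (A - B)`. -/
theorem Matrix.det_fromBlocks_same {n R : Type*} [Fintype n] [DecidableEq n] [CommRing R]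
    (A B : Matrix n n R) :
    (Matrix.fromBlocks A B B A).det = (A + B).det * (A - B).det := by
  have h : Matrix.fromBlocks 1 1 0 1 * Matrix.fromBlocks A B B A * Matrix.fromBlocks 1 (-1) 0 1 =
      Matrix.fromBlocks (A + B) 0 B (A - B) := by
    simp [Matrix.fromBlocks_multiply, sub_eq_add_neg, add_comm]
    abel
  simpa using congrArg Matrix.det h

/-- Enumeration of `Fin (2 * m)` outwards from the middle: `inl j` is sent to `m + j` and `inr j`
to `m - 1 - j`. -/
def finCenterEquiv (m : ℕ) : Fin m ⊕ Fin m ≃ Fin (2 * m) :=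
  (Equiv.sumComm _ _).trans <| (Equiv.sumCongr Fin.revPerm (Equiv.refl _)).trans <|
    finSumFinEquiv.trans (finCongr (two_mul m).symm)

theorem finCenterEquiv_inl (m : ℕ) (j : Fin m) :
    (((finCenterEquiv m (.inl j) : Fin (2 * m)) : ℕ) : ℤ) = m + j := by
  simp [finCenterEquiv, add_comm]

theorem finCenterEquiv_inr (m : ℕ) (j : Fin m) :
    (((finCenterEquiv m (.inr j) : Fin (2 * m)) : ℕ) : ℤ) = m - 1 - j := by
  simp [finCenterEquiv, Fin.val_rev]
  omega


/-- Factorization of an even-size Toeplitz determinant with even symbol into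
"Toeplitz plus Hankel" and "Toeplitz minus Hankel" determinants:
`det (c_{j-k})_{0 ≤ j,k < 2m} = det (c_{j-k} + c_{j+k+1})_{0 ≤ j,k < m} · det (c_{j-k} - c_{j+k+1})_{0 ≤ j,k < m}`. -/
theorem toeplitz_factor_even (m : ℕ) (hm : 1 ≤ m) (c : ℤ → ℂ)
    (hc : ∀ n : ℤ, c (-n) = c n) :
    (Matrix.of fun j k : Fin (2 * m) => c (((j : ℕ) : ℤ) - ((k : ℕ) : ℤ))).det =
      (Matrix.of fun j k : Fin m =>
          c (((j : ℕ) : ℤ) - ((k : ℕ) : ℤ)) + c (((j : ℕ) : ℤ) + ((k : ℕ) : ℤ) + 1)).det *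
      (Matrix.of fun j k : Fin m =>
          c (((j : ℕ) : ℤ) - ((k : ℕ) : ℤ)) - c (((j : ℕ) : ℤ) + ((k : ℕ) : ℤ) + 1)).det := by
  rw [← Matrix.det_submatrix_equiv_self (finCenterEquiv m)]
  let A : Matrix (Fin m) (Fin m) ℂ := .of fun j k => c (((j : ℕ) : ℤ) - ((k : ℕ) : ℤ))
  let B : Matrix (Fin m) (Fin m) ℂ := .of fun j k => c (((j : ℕ) : ℤ) + ((k : ℕ) : ℤ) + 1)
  refine Eq.trans (congrArg Matrix.det ?_) (Matrix.det_fromBlocks_same A B)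
  ext (j | j) (k | k) <;>
    simp only [A, B, Matrix.submatrix_apply, Matrix.of_apply, finCenterEquiv_inl,
      finCenterEquiv_inr, Matrix.fromBlocks_apply₁₁, Matrix.fromBlocks_apply₁₂,
      Matrix.fromBlocks_apply₂₁, Matrix.fromBlocks_apply₂₂]
  · congr 1; ring
  · congr 1; ring
  · rw [← hc]; congr 1; ring
  · rw [← hc]; congr 1; ring
end

section
/- Let m ≥ 0 and let c : ℤ → ℂ be an even sequence, i.e. c(−n) = c(n) for all n ∈ ℤ. Then the (2m+1)×(2m+1) Toeplitz determinant factors as det[(c(j−k))_{0≤j,k≤2m}] = det[(c(j−k) − c(j+k+2))_{0≤j,k≤m−1}] · (1/2) · det[(c(j−k) + c(j+k))_{0≤j,k≤m}], where for m = 0 the first (empty) determinant equals 1. -/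
open Matrix

/-- Subtracting from each row of the first block a row of the second one, and adding each column of
the first block to the corresponding column of the second one, splits the determinant if the
upper right block becomes zero. -/
theorem Matrix.det_fromBlocks_of_elimination {ι κ R : Type*} [Fintype ι] [DecidableEq ι]
    [Fintype κ] [DecidableEq κ] [CommRing R] (A : Matrix ι ι R) (B : Matrix ι κ R)
    (C : Matrix κ ι R) (D : Matrix κ κ R) (E : Matrix ι κ R)
    (h : (A - E * C) * E + (B - E * D) = 0) :
    (fromBlocks A B C D).det = (A - E * C).det * (C * E + D).det := by
  have key : fromBlocks 1 (-E) 0 1 * fromBlocks A B C D * fromBlocks 1 E 0 1 =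
      fromBlocks (A - E * C) 0 C (C * E + D) := by
    simp [fromBlocks_multiply, ← sub_eq_add_neg, h]
  have hdet := congrArg det key
  simpa [det_mul, det_fromBlocks_zero₂₁, det_fromBlocks_zero₁₂] using hdet

/-- The matrix of the shift `i ↦ i + 1` from `Fin m` to `Fin (m + 1)`. -/
def succMatrix (m : ℕ) (R : Type*) [Zero R] [One R] : Matrix (Fin m) (Fin (m + 1)) R :=
  of fun i j => if j = i.succ then 1 else 0

theorem succMatrix_mul_apply {m : ℕ} {κ R : Type*} [CommRing R]
    (X : Matrix (Fin (m + 1)) κ R) (i : Fin m) (k : κ) :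
    (succMatrix m R * X) i k = X i.succ k := by
  simp [succMatrix, mul_apply]

theorem mul_succMatrix_apply_zero {m : ℕ} {κ R : Type*} [CommRing R]
    (X : Matrix κ (Fin m) R) (k : κ) : (X * succMatrix m R) k 0 = 0 := by
  simp [succMatrix, mul_apply, (Fin.succ_ne_zero _).symm]

theorem mul_succMatrix_apply_succ {m : ℕ} {κ R : Type*} [CommRing R]
    (X : Matrix κ (Fin m) R) (k : κ) (j : Fin m) :
    (X * succMatrix m R) k j.succ = X k j := by
  simp [succMatrix, mul_apply]

/-- The indices `0, …, 2m` split into those below the midpoint `m`, listed in decreasing order,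
and those from `m` on, listed in increasing order. -/
def splitAtMidpoint (m : ℕ) : Fin m ⊕ Fin (m + 1) ≃ Fin (2 * m + 1) :=
  ((Equiv.sumCongr Fin.revPerm (Equiv.refl _)).trans finSumFinEquiv).trans (finCongr (by omega))

theorem splitAtMidpoint_inl {m : ℕ} (i : Fin m) :
    (((splitAtMidpoint m (Sum.inl i) : Fin (2 * m + 1)) : ℕ) : ℤ) = m - 1 - i := by
  simp [splitAtMidpoint]
  omega

theorem splitAtMidpoint_inr {m : ℕ} (j : Fin (m + 1)) :
    (((splitAtMidpoint m (Sum.inr j) : Fin (2 * m + 1)) : ℕ) : ℤ) = m + j := by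
  simp [splitAtMidpoint]

/-- Factorization of an odd-size Toeplitz determinant with even symbol into a symplectic-type
determinant and an orthogonal-type determinant:
`det (c_{j-k})_{0 ≤ j,k ≤ 2m} = det (c_{j-k} - c_{j+k+2})_{0 ≤ j,k < m} · (1/2) · det (c_{j-k} + c_{j+k})_{0 ≤ j,k ≤ m}`
(for `m = 0` the first, empty, determinant equals `1`). -/
theorem toeplitz_factor_odd (m : ℕ) (c : ℤ → ℂ)
    (hc : ∀ n : ℤ, c (-n) = c n) :
    (Matrix.of fun j k : Fin (2 * m + 1) => c (((j : ℕ) : ℤ) - ((k : ℕ) : ℤ))).det =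
      (Matrix.of fun j k : Fin m =>
          c (((j : ℕ) : ℤ) - ((k : ℕ) : ℤ)) - c (((j : ℕ) : ℤ) + ((k : ℕ) : ℤ) + 2)).det *
      ((1 / 2 : ℂ) *
        (Matrix.of fun j k : Fin (m + 1) =>
            c (((j : ℕ) : ℤ) - ((k : ℕ) : ℤ)) + c (((j : ℕ) : ℤ) + ((k : ℕ) : ℤ))).det) := by
  let A : Matrix (Fin m) (Fin m) ℂ := of fun i k => c ((k : ℤ) - i)
  let B : Matrix (Fin m) (Fin (m + 1)) ℂ := of fun i k => c (-(i + 1) - k : ℤ)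
  let C : Matrix (Fin (m + 1)) (Fin m) ℂ := of fun i k => c (i + k + 1 : ℤ)
  let D : Matrix (Fin (m + 1)) (Fin (m + 1)) ℂ := of fun i k => c ((i : ℤ) - k)
  have c_congr : ∀ {a b : ℤ}, a = b ∨ a = -b → c a = c b := by
    rintro a b (rfl | rfl)
    exacts [rfl, hc b]
  have hblocks : (of fun j k : Fin (2 * m + 1) => c (((j : ℕ) : ℤ) - ((k : ℕ) : ℤ))).submatrix
      (splitAtMidpoint m) (splitAtMidpoint m) = fromBlocks A B C D := by
    ext (i | i) (k | k) <;>
      simp only [submatrix_apply, of_apply, splitAtMidpoint_inl, splitAtMidpoint_inr,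
        fromBlocks_apply₁₁, fromBlocks_apply₁₂, fromBlocks_apply₂₁, fromBlocks_apply₂₂, A, B, C, D]
      <;> exact c_congr (by omega)
  have hsymplectic : A - succMatrix m ℂ * C = of fun j k : Fin m =>
      c (((j : ℕ) : ℤ) - ((k : ℕ) : ℤ)) - c (((j : ℕ) : ℤ) + ((k : ℕ) : ℤ) + 2) := by
    ext i k
    simp only [Matrix.sub_apply, succMatrix_mul_apply, of_apply, Fin.val_succ, A, C]
    congr 1 <;> exact c_congr (by omega)
  have hzero : (A - succMatrix m ℂ * C) * succMatrix m ℂ + (B - succMatrix m ℂ * D) = 0 := by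
    ext i k
    rw [hsymplectic]
    cases k using Fin.cases with
    | zero =>
      simp only [Matrix.add_apply, Matrix.sub_apply, mul_succMatrix_apply_zero, succMatrix_mul_apply,
        of_apply, Matrix.zero_apply, Fin.val_succ, Fin.val_zero, B, D]
      rw [zero_add, sub_eq_zero]
      exact c_congr (by omega)
    | succ k =>
      simp only [Matrix.add_apply, Matrix.sub_apply, mul_succMatrix_apply_succ, succMatrix_mul_apply,
        of_apply, Matrix.zero_apply, Fin.val_succ, B, D]
      rw [c_congr (a := -((i : ℤ) + 1) - ((k : ℕ) + 1 : ℕ)) (b := (i : ℤ) + k + 2) (by omega),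
        c_congr (a := (((i : ℕ) + 1 : ℕ) : ℤ) - ((k : ℕ) + 1 : ℕ)) (b := (i : ℤ) - k) (by omega)]
      ring
  have horthogonal : (of fun j k : Fin (m + 1) =>
      c (((j : ℕ) : ℤ) - ((k : ℕ) : ℤ)) + c (((j : ℕ) : ℤ) + ((k : ℕ) : ℤ))) =
      of fun j k => (Fin.cons 2 fun _ => 1 : Fin (m + 1) → ℂ) k *
        (C * succMatrix m ℂ + D) j k := by
    ext j k
    cases k using Fin.cases with
    | zero =>
      simp [mul_succMatrix_apply_zero, D, two_mul]
    | succ k =>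
      simp [mul_succMatrix_apply_succ, C, D, add_assoc, add_comm]
  rw [← det_submatrix_equiv_self (splitAtMidpoint m), hblocks,
    det_fromBlocks_of_elimination A B C D _ hzero, hsymplectic, horthogonal, det_mul_row,
    Fin.prod_univ_succ]
  simp
end
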